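/- arXiv:1912.04222 — 7 statements merged into one kernel-verified Lean document; each statement's English description precedes it below -/
import Mathlib

section
/- Let O be a finite nonempty set, ε ≥ 0 and α ≥ 0 real numbers, and let u, u' : O → ℝ be two utility functions satisfying |u(o) − u'(o)| ≤ α for every o ∈ O. Then for every o ∈ O, p_{ε,u}(o) ≤ exp(2·α·ε) · p_{ε,u'}(o). (Privacy of the exponential mechanism: if the utility has sensitivity at most α, the exponential mechanism is 2αε-differentially private.) -/
open Real

theorem exp_neg_mul_le_of_abs_sub_le {ε α a b : ℝ} (hε : 0 ≤ ε) (h : |a - b| ≤ α) :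
    Real.exp (-ε * a) ≤ Real.exp (α * ε) * Real.exp (-ε * b) := by
  rw [← Real.exp_add, Real.exp_le_exp]
  have hba : b - a ≤ α := (abs_sub_le_iff.mp h).2
  nlinarith [mul_le_mul_of_nonneg_left hba hε]

/-- Privacy of the exponential mechanism: if two utility functions differ pointwise by at most
`α`, then the corresponding exponential mechanism probabilities differ by a factor of at most
`exp (2·α·ε)`. -/
theorem exponential_mechanism_privacy {O : Type*} [Fintype O] [Nonempty O]
    (ε α : ℝ) (hε : 0 ≤ ε) (hα : 0 ≤ α) (u u' : O → ℝ)
    (hsens : ∀ o : O, |u o - u' o| ≤ α) :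
    ∀ o : O,
      Real.exp (-ε * u o) / (∑ o' : O, Real.exp (-ε * u o')) ≤
        Real.exp (2 * α * ε) *
          (Real.exp (-ε * u' o) / (∑ o' : O, Real.exp (-ε * u' o'))) := by
  intro o
  have hpos (v : O → ℝ) : 0 < ∑ o' : O, Real.exp (-ε * v o') :=
    Finset.sum_pos (fun _ _ => Real.exp_pos _) Finset.univ_nonempty
  have hnum := exp_neg_mul_le_of_abs_sub_le hε (hsens o)
  have hsum : ∑ o' : O, Real.exp (-ε * u' o') ≤
      Real.exp (α * ε) * ∑ o' : O, Real.exp (-ε * u o') := by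
    rw [Finset.mul_sum]
    exact Finset.sum_le_sum fun o' _ =>
      exp_neg_mul_le_of_abs_sub_le hε (abs_sub_comm (u o') (u' o') ▸ hsens o')
  have hexp : Real.exp (2 * α * ε) = Real.exp (α * ε) * Real.exp (α * ε) := by
    rw [← Real.exp_add]
    ring_nf
  rw [← mul_div_assoc, div_le_div_iff₀ (hpos u) (hpos u'), hexp]
  calc _ ≤ (Real.exp (α * ε) * Real.exp (-ε * u' o)) *
        (Real.exp (α * ε) * ∑ o' : O, Real.exp (-ε * u o')) :=
        mul_le_mul hnum hsum (hpos u').le (by positivity)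
    _ = _ := by ring
end

section
/- Let O be a finite nonempty set, η ≥ 0 and α ≥ 0 real numbers, and let u, u' : O → ℝ be two utility functions satisfying |u(o) − u'(o)| ≤ α for every o ∈ O. Then for every o ∈ O, p2_{η,u}(o) ≤ 2^(2·α·η) · p2_{η,u'}(o). (Privacy of the base-2 exponential mechanism: if the utility has sensitivity at most α, the base-2 exponential mechanism is 2αη|₂-differentially private.) -/
open Real

/-- Base-2 exponential weights of scores at distance at most `α` differ by a factor of at most
`2^(α·η)`. -/
lemma two_rpow_neg_mul_le {η α a b : ℝ} (hη : 0 ≤ η) (h : |a - b| ≤ α) :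
    (2 : ℝ) ^ (-η * a) ≤ 2 ^ (α * η) * 2 ^ (-η * b) := by
  rw [← Real.rpow_add two_pos]
  apply Real.rpow_le_rpow_of_exponent_le one_le_two
  nlinarith [mul_le_mul_of_nonneg_left (neg_le_of_abs_le h) hη]

/-- Privacy of the base-2 exponential mechanism: if two utility functions differ pointwise by at
most `α`, then the corresponding base-2 exponential mechanism probabilities differ by a factor
of at most `2^(2·α·η)`. -/
theorem base2_exponential_mechanism_privacy {O : Type*} [Fintype O] [Nonempty O]
    (η α : ℝ) (hη : 0 ≤ η) (hα : 0 ≤ α) (u u' : O → ℝ)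
    (hsens : ∀ o : O, |u o - u' o| ≤ α) :
    ∀ o : O,
      (2 : ℝ) ^ (-η * u o) / (∑ o' : O, (2 : ℝ) ^ (-η * u o')) ≤
        (2 : ℝ) ^ (2 * α * η) *
          ((2 : ℝ) ^ (-η * u' o) / (∑ o' : O, (2 : ℝ) ^ (-η * u' o'))) := by
  intro o
  have hpos (v : O → ℝ) : 0 < ∑ o', (2 : ℝ) ^ (-η * v o') :=
    Finset.sum_pos (fun _ _ => by positivity) Finset.univ_nonempty
  have hsum : ∑ o', (2 : ℝ) ^ (-η * u' o') ≤ 2 ^ (α * η) * ∑ o', (2 : ℝ) ^ (-η * u o') := by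
    rw [Finset.mul_sum]
    exact Finset.sum_le_sum fun o' _ =>
      two_rpow_neg_mul_le hη (by rw [abs_sub_comm]; exact hsens o')
  have hsplit : (2 : ℝ) ^ (2 * α * η) = 2 ^ (α * η) * 2 ^ (α * η) := by
    rw [← Real.rpow_add two_pos]
    ring_nf
  rw [← mul_div_assoc, div_le_div_iff₀ (hpos u) (hpos u'), hsplit]
  calc (2 : ℝ) ^ (-η * u o) * ∑ o', (2 : ℝ) ^ (-η * u' o')
      ≤ (2 ^ (α * η) * 2 ^ (-η * u' o)) * (2 ^ (α * η) * ∑ o', (2 : ℝ) ^ (-η * u o')) :=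
        mul_le_mul (two_rpow_neg_mul_le hη (hsens o)) hsum (hpos u').le (by positivity)
    _ = _ := by ring
end

section
/- Let x, y, z, o_max be positive integers with x ≤ 2^y, and let b_x = ⌊log₂ x⌋ + 1 be the number of bits of x. Let u_min ≤ u_max be integers with 0 ≤ u_min. Then for any list of at most o_max integers u₁, …, u_m (m ≤ o_max) each lying in [u_min, u_max], the sum S = ∑_{i=1}^m (x/2^y)^(z·u_i) satisfies: S · 2^(max(1, u_max)·z·(y + b_x)) is an integer, and S < 2^(max(1, u_min)·z·(y + b_x) + o_max). In particular S can be written exactly in binary with at most (max(1,|u_min|) + max(1,|u_max|))·z·(y + b_x) + o_max bits of precision. -/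
open Finset

/-- A power of a dyadic rational `x / 2 ^ y` becomes an integer after scaling by a large enough
power of two. -/
theorem div_two_pow_pow_mul_two_pow (x y k N : ℕ) (h : y * k ≤ N) :
    ((x : ℝ) / 2 ^ y) ^ k * 2 ^ N = ((x ^ k * 2 ^ (N - y * k) : ℤ) : ℝ) := by
  obtain ⟨d, rfl⟩ := Nat.exists_eq_add_of_le h
  rw [Nat.add_sub_cancel_left, div_pow, pow_add, ← pow_mul]
  push_cast
  field_simp

/-- Worst-case precision bound: for the base-2 exponential mechanism with privacy parameter
`η = -z·log₂(x/2^y)`, any sum of at most `o_max` weights `(x/2^y)^(z·uᵢ)` with integer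
utilities `uᵢ ∈ [u_min, u_max]` has at most `max 1 u_max · z · (y + b_x)` fractional bits and
is smaller than `2 ^ (max 1 u_min · z · (y + b_x) + o_max)`. -/
theorem precision_bound (x y z o_max : ℕ) (hx : 0 < x) (hy : 0 < y) (hz : 0 < z)
    (ho : 0 < o_max) (hxy : x ≤ 2 ^ y) (b_x : ℕ) (hbx : b_x = Nat.log 2 x + 1)
    (u_min u_max : ℤ) (h0 : 0 ≤ u_min) (hmm : u_min ≤ u_max)
    (m : ℕ) (hm : m ≤ o_max) (u : Fin m → ℤ)
    (hu : ∀ i : Fin m, u_min ≤ u i ∧ u i ≤ u_max) :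
    (∃ n : ℤ, (∑ i : Fin m, ((x : ℝ) / 2 ^ y) ^ ((z : ℤ) * u i)) *
        (2 : ℝ) ^ (max 1 u_max * (z : ℤ) * ((y : ℤ) + (b_x : ℤ))) = (n : ℝ)) ∧
      (∑ i : Fin m, ((x : ℝ) / 2 ^ y) ^ ((z : ℤ) * u i)) <
        (2 : ℝ) ^ (max 1 u_min * (z : ℤ) * ((y : ℤ) + (b_x : ℤ)) + (o_max : ℤ)) := by
  have hu0 : ∀ i, 0 ≤ (z : ℤ) * u i := fun i ↦
    mul_nonneg z.cast_nonneg (h0.trans (hu i).1)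
  constructor
  · obtain ⟨N, hN⟩ : ∃ N : ℕ, max 1 u_max * (z : ℤ) * ((y : ℤ) + (b_x : ℤ)) = N :=
      Int.eq_ofNat_of_zero_le (by positivity)
    choose k hk using fun i ↦ Int.eq_ofNat_of_zero_le (hu0 i)
    have hkN : ∀ i, y * k i ≤ N := fun i ↦ by
      zify
      rw [← hN, ← hk i, mul_comm (y : ℤ), mul_comm (z : ℤ)]
      have h := (hu i).2.trans (le_max_right 1 u_max)
      gcongr
      omega
    refine ⟨∑ i, (x : ℤ) ^ k i * 2 ^ (N - y * k i), ?_⟩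
    rw [hN, Finset.sum_mul, Int.cast_sum]
    refine Finset.sum_congr rfl fun i _ ↦ ?_
    rw [hk i, zpow_natCast, zpow_natCast, div_two_pow_pow_mul_two_pow x y (k i) N (hkN i)]
  · have hterm : ∀ i, ((x : ℝ) / 2 ^ y) ^ ((z : ℤ) * u i) ≤ 1 := fun i ↦ by
      obtain ⟨k, hk⟩ := Int.eq_ofNat_of_zero_le (hu0 i)
      rw [hk, zpow_natCast]
      exact pow_le_one₀ (by positivity) (div_le_one_of_le₀ (by exact_mod_cast hxy) (by positivity))
    calc ∑ i : Fin m, ((x : ℝ) / 2 ^ y) ^ ((z : ℤ) * u i)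
        ≤ ∑ _i : Fin m, (1 : ℝ) := Finset.sum_le_sum fun i _ ↦ hterm i
      _ ≤ o_max := by simpa using hm
      _ < (2 : ℝ) ^ (o_max : ℤ) := by
        rw [zpow_natCast]
        exact_mod_cast Nat.lt_two_pow_self
      _ ≤ _ := zpow_le_zpow_right₀ one_le_two (le_add_of_nonneg_left (by positivity))
end

section
/- For s ∈ [0,1) and v ∈ ℝ define ρ_s(v) = ⌈v⌉ if s < v − ⌊v⌋ and ρ_s(v) = ⌊v⌋ otherwise. Then for every s ∈ [0,1), every natural number α, and all real numbers a, b with |a − b| ≤ α, we have |ρ_s(a) − ρ_s(b)| ≤ α. (Rounding two utilities with the same randomness never increases their difference beyond the integer sensitivity bound.) -/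
/-- Randomized rounding with threshold `s ∈ [0, 1)` is the ceiling of the shifted value. -/
theorem ite_ceil_floor_eq_ceil_sub {s : ℝ} (hs : s ∈ Set.Ico (0 : ℝ) 1) (v : ℝ) :
    (if s < v - (⌊v⌋ : ℝ) then (⌈v⌉ : ℝ) else (⌊v⌋ : ℝ)) = (⌈v - s⌉ : ℝ) := by
  obtain ⟨hs0, hs1⟩ := hs
  have hle := Int.floor_le v
  have hlt := Int.lt_floor_add_one v
  split_ifs with h
  · have hv : ⌈v⌉ = ⌊v⌋ + 1 := by
      rw [Int.ceil_eq_iff]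
      push_cast
      constructor <;> linarith
    have hvs : ⌈v - s⌉ = ⌊v⌋ + 1 := by
      rw [Int.ceil_eq_iff]
      push_cast
      constructor <;> linarith
    rw [hv, hvs]
  · have hvs : ⌈v - s⌉ = ⌊v⌋ := by
      rw [Int.ceil_eq_iff]
      constructor <;> linarith
    rw [hvs]

/-- The ceiling function preserves natural-number bounds on differences. -/
theorem abs_ceil_sub_ceil_le {x y : ℝ} {n : ℕ} (h : |x - y| ≤ (n : ℝ)) :
    |(⌈x⌉ : ℝ) - (⌈y⌉ : ℝ)| ≤ (n : ℝ) := by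
  obtain ⟨h₁, h₂⟩ := abs_le.mp h
  have hxy : ⌈x⌉ ≤ ⌈y⌉ + n := by
    rw [← Int.ceil_add_natCast]
    exact Int.ceil_mono (by linarith)
  have hyx : ⌈y⌉ ≤ ⌈x⌉ + n := by
    rw [← Int.ceil_add_natCast]
    exact Int.ceil_mono (by linarith)
  have hint : |⌈x⌉ - ⌈y⌉| ≤ (n : ℤ) := abs_le.mpr ⟨by linarith, by linarith⟩
  exact_mod_cast hint

/-- Randomized rounding with shared randomness never increases the difference of two utilities
beyond the integer sensitivity bound. -/
theorem randomized_rounding_sensitivity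
    (ρ : ℝ → ℝ → ℝ)
    (hρ : ρ = fun (s : ℝ) (v : ℝ) => if s < v - (⌊v⌋ : ℝ) then (⌈v⌉ : ℝ) else (⌊v⌋ : ℝ)) :
    ∀ s ∈ Set.Ico (0 : ℝ) 1, ∀ (α : ℕ) (a b : ℝ),
      |a - b| ≤ (α : ℝ) → |ρ s a - ρ s b| ≤ (α : ℝ) := by
  intro s hs α a b hab
  simp only [hρ, ite_ceil_floor_eq_ceil_sub hs]
  exact abs_ceil_sub_ceil_le (by rwa [sub_sub_sub_cancel_right])
end

section
/- Let O be a finite nonempty set, ε ≥ 0 a real number, α a positive natural number, and let u, u' : O → ℝ satisfy |u(o) − u'(o)| ≤ α for every o ∈ O. Then for every o ∈ O, P_{ε,u}(o) ≤ exp(2·α·ε) · P_{ε,u'}(o). (Privacy of arbitrary-precision randomized rounding: the exponential mechanism with randomized rounding of a utility of sensitivity at most α is 2αε-differentially private.) -/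
open MeasureTheory

/-- Randomized rounding of `v` with randomness `s`. -/
noncomputable def rround (s v : ℝ) : ℝ :=
  if s < v - (⌊v⌋ : ℝ) then (⌈v⌉ : ℝ) else (⌊v⌋ : ℝ)

/-- Probability that the randomized rounding exponential mechanism outputs `o`. -/
noncomputable def rrProb {O : Type*} [Fintype O] (ε : ℝ) (u : O → ℝ) (o : O) : ℝ :=
  ∫ s : O → ℝ,
    Real.exp (-ε * rround (s o) (u o)) /
      (∑ o' : O, Real.exp (-ε * rround (s o') (u o')))
    ∂(Measure.pi fun _ : O => volume.restrict (Set.Ico (0 : ℝ) 1))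

lemma floor_le_rround (s v : ℝ) : (⌊v⌋ : ℝ) ≤ rround s v := by
  unfold rround
  split_ifs
  · exact_mod_cast Int.floor_le_ceil v
  · exact le_rfl

lemma rround_le_floor_add_one (s v : ℝ) : rround s v ≤ (⌊v⌋ : ℝ) + 1 := by
  unfold rround
  split_ifs
  · exact_mod_cast Int.ceil_le_floor_add_one v
  · linarith

lemma rround_mono (s : ℝ) : Monotone (rround s) := by
  intro v w hvw
  rcases (Int.floor_mono hvw).lt_or_eq with h | h
  · have h' : (⌊v⌋ : ℝ) + 1 ≤ ⌊w⌋ := by exact_mod_cast h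
    exact (rround_le_floor_add_one s v).trans (h'.trans (floor_le_rround s w))
  · by_cases hs : s < v - (⌊v⌋ : ℝ)
    · have hs' : s < w - (⌊w⌋ : ℝ) := by rw [← h]; linarith
      rw [rround, rround, if_pos hs, if_pos hs']
      exact_mod_cast Int.ceil_mono hvw
    · rw [rround, if_neg hs, h]
      exact floor_le_rround s w

lemma rround_add_natCast (s v : ℝ) (n : ℕ) : rround s (v + n) = rround s v + n := by
  simp only [rround, Int.floor_add_natCast, Int.ceil_add_natCast, Int.cast_add, Int.cast_natCast,
    add_sub_add_right_eq_sub]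
  split_ifs <;> rfl

lemma rround_le_add_of_le_add (s : ℝ) {v w : ℝ} {n : ℕ} (h : v ≤ w + n) :
    rround s v ≤ rround s w + n :=
  (rround_mono s h).trans_eq (rround_add_natCast s w n)

lemma measurable_rround_left (v : ℝ) : Measurable fun s => rround s v :=
  Measurable.ite measurableSet_Iio measurable_const measurable_const

lemma exp_neg_mul_le_of_le_add {ε a b c : ℝ} (hε : 0 ≤ ε) (h : b ≤ a + c) :
    Real.exp (-ε * a) ≤ Real.exp (c * ε) * Real.exp (-ε * b) := by
  rw [← Real.exp_add, Real.exp_le_exp]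
  nlinarith [mul_le_mul_of_nonneg_left h hε]

/-- Perturbing the exponents by at most `c` changes a softmax weight by a factor at most
`exp (2 * c * ε)`. -/
lemma exp_div_sum_exp_le {O : Type*} [Fintype O] {ε c : ℝ} (hε : 0 ≤ ε) {a b : O → ℝ}
    (hab : ∀ o, a o ≤ b o + c) (hba : ∀ o, b o ≤ a o + c) (o : O) :
    Real.exp (-ε * a o) / ∑ o', Real.exp (-ε * a o') ≤
      Real.exp (2 * c * ε) * (Real.exp (-ε * b o) / ∑ o', Real.exp (-ε * b o')) := by
  have hpos (f : O → ℝ) : 0 < ∑ o', Real.exp (-ε * f o') :=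
    Finset.sum_pos (fun _ _ => Real.exp_pos _) ⟨o, Finset.mem_univ o⟩
  have hsum : ∑ o', Real.exp (-ε * b o') ≤
      Real.exp (c * ε) * ∑ o', Real.exp (-ε * a o') := by
    rw [Finset.mul_sum]
    exact Finset.sum_le_sum fun o' _ => exp_neg_mul_le_of_le_add hε (hab o')
  rw [← mul_div_assoc, div_le_div_iff₀ (hpos a) (hpos b)]
  calc Real.exp (-ε * a o) * ∑ o', Real.exp (-ε * b o')
      ≤ (Real.exp (c * ε) * Real.exp (-ε * b o)) *
          (Real.exp (c * ε) * ∑ o', Real.exp (-ε * a o')) :=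
        mul_le_mul (exp_neg_mul_le_of_le_add hε (hba o)) hsum (hpos b).le (by positivity)
    _ = Real.exp (2 * c * ε) * Real.exp (-ε * b o) * ∑ o', Real.exp (-ε * a o') := by
        rw [show 2 * c * ε = c * ε + c * ε by ring, Real.exp_add]
        ring

lemma integrable_rrProb_integrand {O : Type*} [Fintype O] (ε : ℝ) (u : O → ℝ) (o : O) :
    Integrable (fun s : O → ℝ => Real.exp (-ε * rround (s o) (u o)) /
      (∑ o' : O, Real.exp (-ε * rround (s o') (u o'))))
      (Measure.pi fun _ : O => volume.restrict (Set.Ico (0 : ℝ) 1)) := by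
  have hmeas (o' : O) : Measurable fun s : O → ℝ => Real.exp (-ε * rround (s o') (u o')) :=
    (((measurable_rround_left (u o')).comp (measurable_pi_apply o')).const_mul (-ε)).exp
  refine Integrable.of_bound
    ((hmeas o).div (Finset.measurable_fun_sum _ fun o' _ => hmeas o')).aestronglyMeasurable 1
    (Filter.Eventually.of_forall fun s => ?_)
  have hsum : 0 ≤ ∑ o' : O, Real.exp (-ε * rround (s o') (u o')) :=
    Finset.sum_nonneg fun _ _ => (Real.exp_pos _).le
  rw [Real.norm_of_nonneg (div_nonneg (Real.exp_pos _).le hsum)]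
  exact div_le_one_of_le₀ (Finset.single_le_sum
    (f := fun o' => Real.exp (-ε * rround (s o') (u o')))
    (fun _ _ => (Real.exp_pos _).le) (Finset.mem_univ o)) hsum

/-- Privacy of arbitrary-precision randomized rounding: if two utilities differ pointwise by at
most the integer `α`, the randomized rounding exponential mechanism probabilities differ by a
factor of at most `exp (2·α·ε)`. -/
theorem randomized_rounding_exponential_mechanism_privacy
    {O : Type*} [Fintype O] [Nonempty O] (ε : ℝ) (hε : 0 ≤ ε)
    (α : ℕ) (hα : 0 < α) (u u' : O → ℝ)
    (hsens : ∀ o : O, |u o - u' o| ≤ (α : ℝ)) :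
    ∀ o : O, rrProb ε u o ≤ Real.exp (2 * α * ε) * rrProb ε u' o := by
  intro o
  unfold rrProb
  rw [← integral_const_mul]
  refine integral_mono (integrable_rrProb_integrand ε u o)
    ((integrable_rrProb_integrand ε u' o).const_mul _) fun s => ?_
  exact exp_div_sum_exp_le (a := fun o => rround (s o) (u o)) (b := fun o => rround (s o) (u' o)) hε
    (fun o' => rround_le_add_of_le_add _ (by linarith [(abs_le.mp (hsens o')).2]))
    (fun o' => rround_le_add_of_le_add _ (by linarith [(abs_le.mp (hsens o')).1])) o
end

section
/- Let O be a finite nonempty set, ε ≥ 0 a real number, u : O → ℝ a utility function, and ρ : O → ℝ any function satisfying |ρ(o) − u(o)| ≤ 1 for every o ∈ O. Then for every o ∈ O, exp(−2ε) · p_{ε,u}(o) ≤ p_{ε,ρ}(o) ≤ exp(2ε) · p_{ε,u}(o). -/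
open Real

/-- One-sided multiplicative bound between the exponential mechanism probabilities of two
utilities at pointwise distance at most `1`. -/
theorem exp_div_sum_exp_le_of_abs_sub_le_one {O : Type*} [Fintype O] [Nonempty O]
    {ε : ℝ} (hε : 0 ≤ ε) {v w : O → ℝ} (h : ∀ o : O, |v o - w o| ≤ 1) (o : O) :
    Real.exp (-ε * v o) / (∑ o' : O, Real.exp (-ε * v o')) ≤
      Real.exp (2 * ε) * (Real.exp (-ε * w o) / (∑ o' : O, Real.exp (-ε * w o'))) := by
  have hv : 0 < ∑ o' : O, Real.exp (-ε * v o') :=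
    Finset.sum_pos (fun _ _ => Real.exp_pos _) Finset.univ_nonempty
  have hw : 0 < ∑ o' : O, Real.exp (-ε * w o') :=
    Finset.sum_pos (fun _ _ => Real.exp_pos _) Finset.univ_nonempty
  have hnum : Real.exp (-ε * v o) ≤ Real.exp ε * Real.exp (-ε * w o) := by
    rw [← Real.exp_add, Real.exp_le_exp]
    nlinarith [(abs_le.mp (h o)).1]
  have hden : ∑ o' : O, Real.exp (-ε * w o') ≤
      Real.exp ε * ∑ o' : O, Real.exp (-ε * v o') := by
    rw [Finset.mul_sum]
    refine Finset.sum_le_sum fun o' _ => ?_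
    rw [← Real.exp_add, Real.exp_le_exp]
    nlinarith [(abs_le.mp (h o')).2]
  rw [← mul_div_assoc, div_le_div_iff₀ hv hw]
  calc
    Real.exp (-ε * v o) * ∑ o' : O, Real.exp (-ε * w o') ≤
        (Real.exp ε * Real.exp (-ε * w o)) *
          (Real.exp ε * ∑ o' : O, Real.exp (-ε * v o')) := by gcongr
    _ = Real.exp (2 * ε) * Real.exp (-ε * w o) * ∑ o' : O, Real.exp (-ε * v o') := by
      rw [two_mul, Real.exp_add]
      ring

/-- If `ρ` approximates `u` pointwise within `1`, then the exponential mechanism probabilities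
with utilities `ρ` are within a factor of `exp (2ε)` of those with utilities `u`. -/
theorem exponential_mechanism_rounding_error {O : Type*} [Fintype O] [Nonempty O]
    (ε : ℝ) (hε : 0 ≤ ε) (u ρ : O → ℝ) (hρ : ∀ o : O, |ρ o - u o| ≤ 1) :
    ∀ o : O,
      Real.exp (-2 * ε) *
          (Real.exp (-ε * u o) / (∑ o' : O, Real.exp (-ε * u o'))) ≤
        Real.exp (-ε * ρ o) / (∑ o' : O, Real.exp (-ε * ρ o')) ∧
      Real.exp (-ε * ρ o) / (∑ o' : O, Real.exp (-ε * ρ o')) ≤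
        Real.exp (2 * ε) *
          (Real.exp (-ε * u o) / (∑ o' : O, Real.exp (-ε * u o'))) := by
  intro o
  refine ⟨?_, exp_div_sum_exp_le_of_abs_sub_le_one hε hρ o⟩
  rw [neg_mul, Real.exp_neg, inv_mul_le_iff₀ (Real.exp_pos _)]
  exact exp_div_sum_exp_le_of_abs_sub_le_one hε (fun o' => abs_sub_comm (u o') _ ▸ hρ o') o
end

section
/- Let O be a finite set with at least two elements, ε ≥ 0 a real number, and u : O → ℝ a utility function. For each o ∈ O define f_o = u(o) − ⌊u(o)⌋, E_o = f_o·exp(−ε·⌈u(o)⌉) + (1 − f_o)·exp(−ε·⌊u(o)⌋), M_o = ∑_{o' ∈ O, o' ≠ o} E_{o'}, and q_o = (1 − f_o)·exp(−ε·⌊u(o)⌋)/(exp(−ε·⌊u(o)⌋) + M_o) + f_o·exp(−ε·⌈u(o)⌉)/(exp(−ε·⌈u(o)⌉) + M_o). Then for every o ∈ O, the probability that the randomized rounding exponential mechanism outputs o satisfies P_{ε,u}(o) ≥ q_o. -/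
open MeasureTheory

open ProbabilityTheory

/-- The uniform probability measure on `[0, 1)`. -/
noncomputable abbrev unifIco : Measure ℝ := volume.restrict (Set.Ico (0 : ℝ) 1)

instance : IsProbabilityMeasure unifIco := ⟨by simp⟩

lemma measurable_comp_rround (F : ℝ → ℝ) (v : ℝ) : Measurable fun s => F (rround s v) := by
  simp only [rround, apply_ite F]
  exact Measurable.ite measurableSet_Iio measurable_const measurable_const

lemma integrable_comp_rround (F : ℝ → ℝ) (v : ℝ) :
    Integrable (fun s => F (rround s v)) unifIco := by
  refine Integrable.of_bound (measurable_comp_rround F v).aestronglyMeasurable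
    (|F ⌈v⌉| + |F ⌊v⌋|) (Filter.Eventually.of_forall fun s => ?_)
  simp only [rround, Real.norm_eq_abs]
  split_ifs
  · linarith [abs_nonneg (F ⌊v⌋)]
  · linarith [abs_nonneg (F ⌈v⌉)]

lemma integral_comp_rround (F : ℝ → ℝ) (v : ℝ) :
    ∫ s, F (rround s v) ∂unifIco =
      (v - ⌊v⌋) * F ⌈v⌉ + (1 - (v - ⌊v⌋)) * F ⌊v⌋ := by
  have h0 : 0 ≤ v - ⌊v⌋ := sub_nonneg.2 (Int.floor_le v)
  have h1 : v - ⌊v⌋ ≤ 1 := by linarith [Int.lt_floor_add_one v]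
  have hdecomp : ∀ s, F (rround s v) =
      (Set.Iio (v - (⌊v⌋ : ℝ))).indicator (fun _ => F ⌈v⌉ - F ⌊v⌋) s + F ⌊v⌋ := by
    intro s
    simp only [rround, Set.indicator, Set.mem_Iio]
    split_ifs <;> ring
  have hinter : Set.Iio (v - (⌊v⌋ : ℝ)) ∩ Set.Ico 0 1 = Set.Ico 0 (v - (⌊v⌋ : ℝ)) := by
    ext s
    simp only [Set.mem_inter_iff, Set.mem_Iio, Set.mem_Ico]
    constructor
    · rintro ⟨h, h', -⟩
      exact ⟨h', h⟩
    · rintro ⟨h, h'⟩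
      exact ⟨h', h, h'.trans_le h1⟩
  simp only [hdecomp]
  rw [integral_add ((integrable_const _).indicator measurableSet_Iio) (integrable_const _),
    integral_indicator_const _ measurableSet_Iio, measureReal_restrict_apply measurableSet_Iio,
    hinter, Real.volume_real_Ico_of_le h0, integral_const, probReal_univ]
  simp only [smul_eq_mul]
  ring

/-- The tangent line of `y ↦ a / (a + y)` at `m` lies below its graph. -/
lemma tangent_le_div_add {a y m : ℝ} (ha : 0 < a) (hy : 0 ≤ y) (hm : 0 ≤ m) :
    a / (a + m) - a / (a + m) ^ 2 * (y - m) ≤ a / (a + y) := by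
  have h1 : 0 < a + m := by linarith
  have h2 : 0 < a + y := by linarith
  have h : a / (a + y) - (a / (a + m) - a / (a + m) ^ 2 * (y - m)) =
      a * (y - m) ^ 2 / ((a + m) ^ 2 * (a + y)) := by
    field_simp
    ring
  have : 0 ≤ a * (y - m) ^ 2 / ((a + m) ^ 2 * (a + y)) := by positivity
  linarith

section Pi

variable {O : Type*} [Fintype O]

lemma integrable_comp_rround_eval (F : ℝ → ℝ) (v : ℝ) (o : O) :
    Integrable (fun s : O → ℝ => F (rround (s o) v)) (Measure.pi fun _ : O => unifIco) :=
  (measurePreserving_eval (fun _ : O => unifIco) o).integrable_comp_of_integrable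
    (integrable_comp_rround F v)

lemma integral_comp_rround_eval (F : ℝ → ℝ) (v : ℝ) (o : O) :
    ∫ s : O → ℝ, F (rround (s o) v) ∂(Measure.pi fun _ : O => unifIco) =
      (v - ⌊v⌋) * F ⌈v⌉ + (1 - (v - ⌊v⌋)) * F ⌊v⌋ := by
  rw [← integral_comp_rround]
  exact integral_comp_eval (μ := fun _ : O => unifIco) (i := o)
    (integrable_comp_rround F v).aestronglyMeasurable

lemma indepFun_comp_rround_eval (F G : ℝ → ℝ) (v w : ℝ) {o o' : O} (h : o ≠ o') :
    IndepFun (fun s : O → ℝ => F (rround (s o) v)) (fun s : O → ℝ => G (rround (s o') w))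
      (Measure.pi fun _ : O => unifIco) :=
  ((iIndepFun_pi (μ := fun _ : O => unifIco) (X := fun _ x => x)
    fun _ => aemeasurable_id).indepFun h).comp
    (measurable_comp_rround F v) (measurable_comp_rround G w)

end Pi

open Finset in
/-- Lower bound on the probability that the randomized rounding exponential mechanism outputs
a given outcome `o` (Lemma on accuracy bounds, part 1). -/
theorem randomized_rounding_lower_bound
    {O : Type*} [Fintype O] [Nontrivial O] [DecidableEq O]
    (ε : ℝ) (hε : 0 ≤ ε) (u : O → ℝ)
    (f E M q : O → ℝ)
    (hf : ∀ o : O, f o = u o - (⌊u o⌋ : ℝ))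
    (hE : ∀ o : O, E o =
      f o * Real.exp (-ε * (⌈u o⌉ : ℝ)) + (1 - f o) * Real.exp (-ε * (⌊u o⌋ : ℝ)))
    (hM : ∀ o : O, M o = ∑ o' ∈ Finset.univ.erase o, E o')
    (hq : ∀ o : O, q o =
      (1 - f o) * Real.exp (-ε * (⌊u o⌋ : ℝ)) /
          (Real.exp (-ε * (⌊u o⌋ : ℝ)) + M o) +
        f o * Real.exp (-ε * (⌈u o⌉ : ℝ)) /
          (Real.exp (-ε * (⌈u o⌉ : ℝ)) + M o)) :
    ∀ o : O, q o ≤ rrProb ε u o := by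
  intro o
  set μ : Measure (O → ℝ) := Measure.pi fun _ : O => unifIco
  have hf0 : ∀ o, 0 ≤ f o := fun o => by
    rw [hf]
    exact sub_nonneg.2 (Int.floor_le _)
  have hf1 : ∀ o, 0 ≤ 1 - f o := fun o => by
    rw [hf]
    linarith [Int.lt_floor_add_one (u o)]
  have hM0 : 0 ≤ M o := by
    rw [hM]
    refine sum_nonneg fun o' _ => ?_
    rw [hE]
    have := hf0 o'
    have := hf1 o'
    positivity
  let X : O → (O → ℝ) → ℝ := fun o' s => Real.exp (-ε * rround (s o') (u o'))
  let A : ℝ → ℝ := fun r => Real.exp (-ε * r) / (Real.exp (-ε * r) + M o)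
  let G : ℝ → ℝ := fun r => Real.exp (-ε * r) / (Real.exp (-ε * r) + M o) ^ 2
  have hXpos : ∀ o' s, 0 < X o' s := fun _ _ => Real.exp_pos _
  have hXmeas : ∀ o', Measurable (X o') := fun o' =>
    (measurable_comp_rround (fun r => Real.exp (-ε * r)) (u o')).comp (measurable_pi_apply o')
  have hA : ∫ s, A (rround (s o) (u o)) ∂μ = q o := by
    rw [integral_comp_rround_eval, hq, ← hf o]
    simp only [A]
    ring
  have hAi : Integrable (fun s => A (rround (s o) (u o))) μ := integrable_comp_rround_eval A _ o
  have hcov : ∀ o' ∈ univ.erase o,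
      Integrable (fun s => G (rround (s o) (u o)) * (X o' s - E o')) μ ∧
        ∫ s, G (rround (s o) (u o)) * (X o' s - E o') ∂μ = 0 := by
    intro o' ho'
    have hind := indepFun_comp_rround_eval G (fun r => Real.exp (-ε * r) - E o') (u o) (u o')
      (ne_of_mem_erase ho').symm
    have hG := integrable_comp_rround_eval G (u o) o
    have hX := integrable_comp_rround_eval (fun r => Real.exp (-ε * r) - E o') (u o') o'
    refine ⟨hind.integrable_mul hG hX, ?_⟩
    refine (hind.integral_fun_mul_eq_mul_integral hG.aestronglyMeasurable
      hX.aestronglyMeasurable).trans ?_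
    rw [integral_comp_rround_eval (fun r => Real.exp (-ε * r) - E o'), ← hf o', hE o']
    ring
  have hsum : ∀ s, G (rround (s o) (u o)) * (∑ o' ∈ univ.erase o, X o' s - M o) =
      ∑ o' ∈ univ.erase o, G (rround (s o) (u o)) * (X o' s - E o') := fun s => by
    rw [hM, ← sum_sub_distrib, mul_sum]
  have hGi : Integrable
      (fun s => G (rround (s o) (u o)) * (∑ o' ∈ univ.erase o, X o' s - M o)) μ := by
    simp only [hsum]
    exact integrable_finsetSum _ fun o' ho' => (hcov o' ho').1
  have hG : ∫ s, G (rround (s o) (u o)) * (∑ o' ∈ univ.erase o, X o' s - M o) ∂μ = 0 := by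
    simp only [hsum]
    rw [integral_finsetSum _ fun o' ho' => (hcov o' ho').1]
    exact sum_eq_zero fun o' ho' => (hcov o' ho').2
  have hle : ∀ s, X o s ≤ ∑ o', X o' s := fun s =>
    single_le_sum (fun o' _ => (hXpos o' s).le) (mem_univ o)
  have hPi : Integrable (fun s => X o s / ∑ o', X o' s) μ := by
    refine Integrable.of_bound
      ((hXmeas o).div (measurable_fun_sum _ fun o' _ => hXmeas o')).aestronglyMeasurable 1
      (Filter.Eventually.of_forall fun s => ?_)
    have hpos := (hXpos o s).trans_le (hle s)
    rw [Real.norm_of_nonneg (div_nonneg (hXpos o s).le hpos.le)]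
    exact (div_le_one hpos).2 (hle s)
  calc
    q o = ∫ s, (A (rround (s o) (u o)) -
        G (rround (s o) (u o)) * (∑ o' ∈ univ.erase o, X o' s - M o)) ∂μ := by
      rw [integral_sub hAi hGi, hA, hG, sub_zero]
    _ ≤ ∫ s, X o s / ∑ o', X o' s ∂μ := by
      refine integral_mono (hAi.sub hGi) hPi fun s => ?_
      rw [← add_sum_erase univ (fun o' => X o' s) (mem_univ o)]
      exact tangent_le_div_add (hXpos o s) (sum_nonneg fun o' _ => (hXpos o' s).le) hM0
    _ = rrProb ε u o := rfl
end
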